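/- Let a ∈ (-n, ∞), b ∈ ℝ, and w(x) := |x|^a (log(2+|x|))^b on ℝⁿ. Then for every λ ∈ [1, ∞) and every cube Q ⊂ ℝⁿ, w(λQ)/w(Q) is comparable to λⁿ · ((|c_Q| + λℓ(Q))/(|c_Q| + ℓ(Q)))^a · (log(2 + |c_Q| + λℓ(Q))/log(2 + |c_Q| + ℓ(Q)))^b, where c_Q is the center and ℓ(Q) the edge length of Q, with implicit constants depending only on n, a, b. -/

import Mathlib

open MeasureTheory

/-- The Euclidean norm on `ℝⁿ` realized as `Fin n → ℝ`. -/
noncomputable def euclNorm {n : ℕ} (x : Fin n → ℝ) : ℝ :=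
  Real.sqrt (∑ i, x i ^ 2)

/-- The axis-parallel cube with center `c` and edge length `l`. -/
def cubeC {n : ℕ} (c : Fin n → ℝ) (l : ℝ) : Set (Fin n → ℝ) :=
  {y | ∀ i, |y i - c i| ≤ l / 2}

/-- For `α > 0` the function `r ↦ r ^ α * log (2 + r) ^ b` is almost increasing. -/
lemma rpow_mul_log_rpow_almost_mono {α : ℝ} (hα : 0 < α) (b : ℝ) {K : ℝ} (hK : 1 ≤ K) :
    ∃ C : ℝ, 0 < C ∧ ∀ r R : ℝ, 0 < r → 0 < R → r ≤ K * R →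
      r ^ α * Real.log (2 + r) ^ b ≤ C * (R ^ α * Real.log (2 + R) ^ b) := by
  have hlog2 : 0 < Real.log 2 := Real.log_pos (by norm_num)
  have hlog : ∀ t : ℝ, 0 < t → Real.log 2 ≤ Real.log (2 + t) := fun t ht =>
    Real.log_le_log (by norm_num) (by linarith)
  have hdil : ∀ t T u : ℝ, 0 < t → 0 < T → 1 ≤ u → T ≤ u * t →
      Real.log (2 + T) ≤ Real.log u + Real.log (2 + t) := by
    intro t T u ht hT hu hTu
    rw [← Real.log_mul (by positivity) (by positivity)]
    exact Real.log_le_log (by positivity) (by nlinarith)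
  have hK0 : 0 < K := by linarith
  rcases le_or_gt 0 b with hb | hb
  · have hlogK : 0 ≤ Real.log K := Real.log_nonneg hK
    set D := Real.log K / Real.log 2 + 1 with hD
    have hD0 : 0 < D := by positivity
    refine ⟨K ^ α * D ^ b, by positivity, fun r R hr hR hrR => ?_⟩
    have hLr : 0 < Real.log (2 + r) := hlog2.trans_le (hlog r hr)
    have hLR : 0 < Real.log (2 + R) := hlog2.trans_le (hlog R hR)
    have hcomp : Real.log (2 + r) ≤ D * Real.log (2 + R) := by
      have h := hdil R r K hR hr hK hrR
      have h' : Real.log K ≤ Real.log K / Real.log 2 * Real.log (2 + R) := by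
        rw [div_mul_eq_mul_div, le_div_iff₀ hlog2]
        exact mul_le_mul_of_nonneg_left (hlog R hR) hlogK
      rw [hD]; linarith
    calc r ^ α * Real.log (2 + r) ^ b
        ≤ (K * R) ^ α * (D * Real.log (2 + R)) ^ b := by gcongr
      _ = K ^ α * D ^ b * (R ^ α * Real.log (2 + R) ^ b) := by
        rw [Real.mul_rpow hK0.le hR.le, Real.mul_rpow hD0.le hLR.le]; ring
  · set δ := α / (-b) with hδ
    have hδ0 : 0 < δ := div_pos hα (by linarith)
    set D := 1 / δ / Real.log 2 + 1 with hD
    have hD0 : 0 < D := by positivity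
    refine ⟨K ^ α * D ^ (-b), by positivity, fun r R hr hR hrR => ?_⟩
    have hLr : 0 < Real.log (2 + r) := hlog2.trans_le (hlog r hr)
    have hLR : 0 < Real.log (2 + R) := hlog2.trans_le (hlog R hR)
    set u := K * R / r with hu
    have hu1 : 1 ≤ u := by rw [hu, le_div_iff₀ hr]; linarith
    have hu0 : 0 < u := by linarith
    have hur : u * r = K * R := by rw [hu]; field_simp
    have hcomp : Real.log (2 + R) ≤ D * u ^ δ * Real.log (2 + r) := by
      have h := hdil r R u hr hR hu1 (by rw [hur]; nlinarith)
      have h1 : Real.log u ≤ u ^ δ / δ := Real.log_le_rpow_div hu0.le hδ0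
      have h2 : 1 ≤ u ^ δ := Real.one_le_rpow hu1 hδ0.le
      have h3 : u ^ δ / δ ≤ 1 / δ / Real.log 2 * u ^ δ * Real.log (2 + r) := by
        have : u ^ δ / δ = 1 / δ / Real.log 2 * u ^ δ * Real.log 2 := by field_simp
        rw [this]
        exact mul_le_mul_of_nonneg_left (hlog r hr) (by positivity)
      have h4 : Real.log (2 + r) ≤ u ^ δ * Real.log (2 + r) := le_mul_of_one_le_left hLr.le h2
      rw [hD]; linarith
    have hpow : Real.log (2 + R) ^ (-b) ≤ D ^ (-b) * u ^ α * Real.log (2 + r) ^ (-b) := by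
      calc Real.log (2 + R) ^ (-b) ≤ (D * u ^ δ * Real.log (2 + r)) ^ (-b) :=
            Real.rpow_le_rpow hLR.le hcomp (by linarith)
        _ = D ^ (-b) * u ^ α * Real.log (2 + r) ^ (-b) := by
          rw [Real.mul_rpow (by positivity) hLr.le, Real.mul_rpow hD0.le (by positivity),
            ← Real.rpow_mul hu0.le, hδ, div_mul_cancel₀ _ (by linarith)]
    rw [Real.rpow_neg hLR.le, Real.rpow_neg hLr.le] at hpow
    have hPr : 0 < Real.log (2 + r) ^ b := by positivity
    have hPR : 0 < Real.log (2 + R) ^ b := by positivity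
    have hinv : Real.log (2 + r) ^ b ≤ D ^ (-b) * u ^ α * Real.log (2 + R) ^ b := by
      rw [← div_eq_mul_inv, le_div_iff₀ hPr, inv_mul_le_iff₀ hPR] at hpow
      linarith
    calc r ^ α * Real.log (2 + r) ^ b
        ≤ r ^ α * (D ^ (-b) * u ^ α * Real.log (2 + R) ^ b) := by gcongr
      _ = D ^ (-b) * (u * r) ^ α * Real.log (2 + R) ^ b := by
        rw [Real.mul_rpow hu0.le hr.le]; ring
      _ = K ^ α * D ^ (-b) * (R ^ α * Real.log (2 + R) ^ b) := by
        rw [hur, Real.mul_rpow hK0.le hR.le]; ring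

lemma euclNorm_nonneg {n : ℕ} (x : Fin n → ℝ) : 0 ≤ euclNorm x := Real.sqrt_nonneg _

lemma norm_le_euclNorm {n : ℕ} (x : Fin n → ℝ) : ‖x‖ ≤ euclNorm x := by
  refine (pi_norm_le_iff_of_nonneg (euclNorm_nonneg x)).2 fun i => ?_
  rw [Real.norm_eq_abs]
  exact Real.abs_le_sqrt
    (Finset.single_le_sum (f := fun i => x i ^ 2) (fun j _ => sq_nonneg _) (Finset.mem_univ i))

lemma euclNorm_le_mul_norm {n : ℕ} (hn : 0 < n) (x : Fin n → ℝ) : euclNorm x ≤ n * ‖x‖ := by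
  have hn1 : (1 : ℝ) ≤ n := by exact_mod_cast hn
  refine Real.sqrt_le_iff.2 ⟨by positivity, ?_⟩
  calc ∑ i, x i ^ 2 ≤ ∑ _i : Fin n, ‖x‖ ^ 2 := by
        refine Finset.sum_le_sum fun i _ => ?_
        rw [← sq_abs, ← Real.norm_eq_abs]
        gcongr
        exact norm_le_pi_norm x i
    _ = n * ‖x‖ ^ 2 := by simp
    _ ≤ n * (n * ‖x‖ ^ 2) := le_mul_of_one_le_left (by positivity) hn1
    _ = (n * ‖x‖) ^ 2 := by ring

lemma continuous_euclNorm {n : ℕ} : Continuous (euclNorm (n := n)) := by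
  unfold euclNorm; fun_prop

lemma cubeC_eq_closedBall {n : ℕ} (c : Fin n → ℝ) {l : ℝ} (hl : 0 ≤ l) :
    cubeC c l = Metric.closedBall c (l / 2) := by
  ext y
  rw [Metric.mem_closedBall, dist_pi_le_iff (by positivity)]
  rfl

lemma measurableSet_cubeC {n : ℕ} (c : Fin n → ℝ) {l : ℝ} (hl : 0 ≤ l) :
    MeasurableSet (cubeC c l) := by
  rw [cubeC_eq_closedBall c hl]
  exact Metric.isClosed_closedBall.measurableSet

lemma volume_real_cubeC {n : ℕ} (c : Fin n → ℝ) {l : ℝ} (hl : 0 ≤ l) :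
    volume.real (cubeC c l) = l ^ n := by
  rw [cubeC_eq_closedBall c hl, Measure.real, Real.volume_pi_closedBall c (by positivity),
    ENNReal.toReal_ofReal (by positivity), Fintype.card_fin, mul_div_cancel₀ _ (by norm_num)]

lemma volume_cubeC_ne_top {n : ℕ} (c : Fin n → ℝ) {l : ℝ} (hl : 0 ≤ l) :
    volume (cubeC c l) ≠ ⊤ := by
  rw [cubeC_eq_closedBall c hl]
  exact measure_closedBall_lt_top.ne

lemma integrableOn_norm_rpow_neg_ball {n : ℕ} (hn : 0 < n) {s : ℝ} (hs : s < n) (r : ℝ) :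
    IntegrableOn (fun x : Fin n → ℝ => ‖x‖ ^ (-s)) (Metric.ball 0 r) := by
  refine integrableOn_ball_of_norm_le_rpow (C := 1) (α := s) (by simpa using Nat.succ_le_of_lt hn) (by simpa using hs)
    (Filter.Eventually.of_forall fun x => ?_)
    (measurable_norm.pow_const _).aestronglyMeasurable
  rw [Real.norm_of_nonneg (by positivity), one_mul]

lemma integrableOn_norm_rpow_neg_cubeC {n : ℕ} (hn : 0 < n) {s : ℝ} (hs : s < n)
    (c : Fin n → ℝ) {l : ℝ} (hl : 0 ≤ l) :
    IntegrableOn (fun x : Fin n → ℝ => ‖x‖ ^ (-s)) (cubeC c l) := by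
  refine (integrableOn_norm_rpow_neg_ball hn hs (‖c‖ + l + 1)).mono_set fun x hx => ?_
  rw [cubeC_eq_closedBall c hl, mem_closedBall_iff_norm'] at hx
  rw [mem_ball_zero_iff]
  have := norm_le_norm_add_norm_sub c x
  linarith

lemma setIntegral_norm_rpow_neg_ball {n : ℕ} (s : ℝ) {r : ℝ} (hr : 0 < r) :
    ∫ x in Metric.ball (0 : Fin n → ℝ) r, ‖x‖ ^ (-s) =
      r ^ n * r ^ (-s) * ∫ x in Metric.ball (0 : Fin n → ℝ) 1, ‖x‖ ^ (-s) := by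
  have h := Measure.setIntegral_comp_smul_of_pos (volume : Measure (Fin n → ℝ))
    (fun x => ‖x‖ ^ (-s)) (Metric.ball 0 1) hr
  have hfun : ∀ x : Fin n → ℝ, ‖r • x‖ ^ (-s) = r ^ (-s) * ‖x‖ ^ (-s) := fun x => by
    rw [norm_smul, Real.norm_of_nonneg hr.le, Real.mul_rpow hr.le (norm_nonneg x)]
  simp only [hfun, integral_const_mul, smul_unitBall_of_pos hr, Module.finrank_fin_fun,
    smul_eq_mul] at h
  rw [mul_assoc, h]
  field_simp

lemma setIntegral_norm_rpow_neg_cubeC_le {n : ℕ} (hn : 0 < n) {s : ℝ} (hs0 : 0 ≤ s)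
    (hs : s < n) :
    ∃ C : ℝ, 0 < C ∧ ∀ (c : Fin n → ℝ) (l : ℝ), 0 < l →
      ∫ x in cubeC c l, ‖x‖ ^ (-s) ≤ C * (l ^ n * (euclNorm c + l) ^ (-s)) := by
  have hn1 : (1 : ℝ) ≤ n := by exact_mod_cast hn
  set I := ∫ x in Metric.ball (0 : Fin n → ℝ) 1, ‖x‖ ^ (-s) with hI
  have hI0 : 0 ≤ I := integral_nonneg fun x => by positivity
  set A : ℝ := (4 * n) ^ s with hA
  set B : ℝ := 2 ^ n * 2 ^ (-s) * (n + 1) ^ s * I with hB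
  have hA0 : 0 < A := by positivity
  have hB0 : 0 ≤ B := by positivity
  refine ⟨A + B, by positivity, fun c l hl => ?_⟩
  have hcE := euclNorm_nonneg c
  have hcn := euclNorm_le_mul_norm hn c
  set R := euclNorm c + l with hR
  have hR0 : 0 < R := by positivity
  rcases le_or_gt l ‖c‖ with hc | hc
  · have hlow : ∀ x ∈ cubeC c l, ‖x‖ ^ (-s) ≤ A * R ^ (-s) := by
      intro x hx
      rw [cubeC_eq_closedBall c hl.le, mem_closedBall_iff_norm] at hx
      have h1 := norm_le_norm_add_norm_sub x c
      have h2 : R / (4 * n) ≤ ‖x‖ := by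
        have h3 : ‖c‖ ≤ 2 * ‖x‖ := by linarith
        rw [div_le_iff₀ (by positivity)]
        nlinarith [mul_le_mul_of_nonneg_left h3 (by positivity : (0 : ℝ) ≤ n)]
      calc ‖x‖ ^ (-s) ≤ (R / (4 * n)) ^ (-s) :=
            Real.rpow_le_rpow_of_nonpos (by positivity) h2 (by linarith)
        _ = A * R ^ (-s) := by
          rw [Real.div_rpow hR0.le (by positivity), Real.rpow_neg (by positivity : 0 ≤ 4 * (n : ℝ)),
            div_inv_eq_mul, mul_comm]
    calc ∫ x in cubeC c l, ‖x‖ ^ (-s) ≤ ∫ _x in cubeC c l, A * R ^ (-s) :=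
          setIntegral_mono_on (integrableOn_norm_rpow_neg_cubeC hn hs c hl.le)
            (integrableOn_const (volume_cubeC_ne_top c hl.le)) (measurableSet_cubeC c hl.le) hlow
      _ = A * (l ^ n * R ^ (-s)) := by
        rw [setIntegral_const, volume_real_cubeC c hl.le, smul_eq_mul]; ring
      _ ≤ (A + B) * (l ^ n * R ^ (-s)) := by gcongr; linarith
  · have hsub : cubeC c l ⊆ Metric.ball 0 (2 * l) := by
      intro x hx
      rw [cubeC_eq_closedBall c hl.le, mem_closedBall_iff_norm'] at hx
      rw [mem_ball_zero_iff]
      have := norm_le_norm_add_norm_sub c x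
      linarith
    have hRl : l ^ (-s) ≤ (n + 1) ^ s * R ^ (-s) := by
      have h1 : R / (n + 1) ≤ l := by
        rw [div_le_iff₀ (by positivity)]
        nlinarith
      calc l ^ (-s) ≤ (R / (n + 1)) ^ (-s) :=
            Real.rpow_le_rpow_of_nonpos (by positivity) h1 (by linarith)
        _ = (n + 1) ^ s * R ^ (-s) := by
          rw [Real.div_rpow hR0.le (by positivity), Real.rpow_neg (by positivity : 0 ≤ (n : ℝ) + 1),
            div_inv_eq_mul, mul_comm]
    calc ∫ x in cubeC c l, ‖x‖ ^ (-s) ≤ ∫ x in Metric.ball 0 (2 * l), ‖x‖ ^ (-s) :=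
          setIntegral_mono_set (integrableOn_norm_rpow_neg_ball hn hs _)
            (Filter.Eventually.of_forall fun x => by positivity) hsub.eventuallyLE
      _ = 2 ^ n * 2 ^ (-s) * I * l ^ n * l ^ (-s) := by
        rw [setIntegral_norm_rpow_neg_ball s (by positivity), mul_pow,
          Real.mul_rpow (by norm_num) hl.le]
        ring
      _ ≤ 2 ^ n * 2 ^ (-s) * I * l ^ n * ((n + 1) ^ s * R ^ (-s)) := by gcongr
      _ = B * (l ^ n * R ^ (-s)) := by rw [hB]; ring
      _ ≤ (A + B) * (l ^ n * R ^ (-s)) := by gcongr; linarith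

lemma euclNorm_le_of_mem_cubeC {n : ℕ} (hn : 0 < n) {c x : Fin n → ℝ} {l : ℝ} (hl : 0 < l)
    (hx : x ∈ cubeC c l) : euclNorm x ≤ 4 * n * (euclNorm c + l) := by
  have hn1 : (1 : ℝ) ≤ n := by exact_mod_cast hn
  rw [cubeC_eq_closedBall c hl.le, mem_closedBall_iff_norm'] at hx
  have h1 := norm_le_norm_add_norm_sub c x
  have h2 := norm_le_euclNorm c
  have h3 : ‖x‖ ≤ 4 * (euclNorm c + l) := by linarith [euclNorm_nonneg c]
  calc euclNorm x ≤ n * ‖x‖ := euclNorm_le_mul_norm hn x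
    _ ≤ n * (4 * (euclNorm c + l)) := by gcongr
    _ = 4 * n * (euclNorm c + l) := by ring

/-- Every cube contains a subcube of a quarter of its edge length that stays away from the
origin. -/
lemma exists_subcube_away_from_zero {n : ℕ} (hn : 0 < n) (c : Fin n → ℝ) {l : ℝ} (hl : 0 < l) :
    ∃ d : Fin n → ℝ, cubeC d (l / 4) ⊆ cubeC c l ∧
      ∀ x ∈ cubeC d (l / 4), euclNorm c + l ≤ 4 * n * euclNorm x := by
  have hn1 : (1 : ℝ) ≤ n := by exact_mod_cast hn
  refine ⟨fun i => if 0 ≤ c i then c i + 3 * l / 8 else c i - 3 * l / 8, fun x hx i => ?_,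
    fun x hx => ?_⟩
  · have h := hx i
    beta_reduce at h
    rw [abs_le] at h ⊢
    split_ifs at h <;> constructor <;> linarith
  · have hxi : ∀ i, |c i| + l / 4 ≤ ‖x‖ := by
      intro i
      have h := hx i
      beta_reduce at h
      have h' := norm_le_pi_norm x i
      rw [Real.norm_eq_abs] at h'
      rw [abs_le] at h
      refine le_trans ?_ h'
      split_ifs at h with h0
      · rw [abs_of_nonneg h0]
        exact le_trans (by linarith) (le_abs_self _)
      · rw [abs_of_neg (not_le.1 h0)]
        exact le_trans (by linarith) (neg_le_abs _)
    have hc : ‖c‖ ≤ ‖x‖ - l / 4 := by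
      refine (pi_norm_le_iff_of_nonneg ?_).2 fun i => ?_
      · linarith [hxi ⟨0, hn⟩, abs_nonneg (c ⟨0, hn⟩)]
      · rw [Real.norm_eq_abs]
        linarith [hxi i]
    have h1 := euclNorm_le_mul_norm hn c
    have h2 := norm_le_euclNorm x
    have h3 := norm_nonneg c
    calc euclNorm c + l ≤ n * ‖c‖ + n * l := by nlinarith
      _ ≤ n * (4 * euclNorm x) := by rw [← mul_add]; gcongr; linarith
      _ = 4 * n * euclNorm x := by ring

/-- The mass of a cube `Q` with respect to the weight `|x| ^ a * log (2 + |x|) ^ b` is comparable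
to `|Q|` times the value of the weight at distance `|c_Q| + ℓ(Q)` from the origin. -/
lemma cubeC_mass_comparable {n : ℕ} (hn : 0 < n) (a b : ℝ) (ha : -(n : ℝ) < a) :
    ∃ A B : ℝ, 0 < A ∧ 0 < B ∧ ∀ (c : Fin n → ℝ) (l : ℝ), 0 < l →
      A * (l ^ n * ((euclNorm c + l) ^ a * Real.log (2 + (euclNorm c + l)) ^ b)) ≤
        (∫ x in cubeC c l, euclNorm x ^ a * Real.log (2 + euclNorm x) ^ b) ∧
      (∫ x in cubeC c l, euclNorm x ^ a * Real.log (2 + euclNorm x) ^ b) ≤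
        B * (l ^ n * ((euclNorm c + l) ^ a * Real.log (2 + (euclNorm c + l)) ^ b)) := by
  have hn1 : (1 : ℝ) ≤ n := by exact_mod_cast hn
  obtain ⟨s, hs0, hsn, has⟩ : ∃ s : ℝ, 0 ≤ s ∧ s < n ∧ 0 < a + s := by
    rcases le_or_gt a 0 with h | h
    · exact ⟨(n - a) / 2, by linarith, by linarith, by linarith⟩
    · exact ⟨0, le_rfl, by linarith, by linarith⟩
  obtain ⟨C, hC, hmono⟩ := rpow_mul_log_rpow_almost_mono has b
    (show (1 : ℝ) ≤ 4 * n by linarith)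
  obtain ⟨D, hD, hcube⟩ := setIntegral_norm_rpow_neg_cubeC_le hn hs0 hsn
  refine ⟨(1 / 4) ^ n * (C * (4 * n) ^ s)⁻¹, C * D, by positivity, by positivity,
    fun c l hl => ?_⟩
  have hcE := euclNorm_nonneg c
  set R := euclNorm c + l with hR
  have hR0 : 0 < R := by positivity
  have hLR : 0 < Real.log (2 + R) := Real.log_pos (by linarith)
  set w : (Fin n → ℝ) → ℝ := fun x => euclNorm x ^ a * Real.log (2 + euclNorm x) ^ b with hw
  have hw0 : ∀ x, 0 ≤ w x := fun x => by
    have h0 := euclNorm_nonneg x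
    have h1 : 0 ≤ Real.log (2 + euclNorm x) := Real.log_nonneg (by linarith)
    positivity
  have hwmeas : Measurable w := by
    have := (continuous_euclNorm (n := n)).measurable
    exact (this.pow_const a).mul ((Real.measurable_log.comp (this.const_add 2)).pow_const b)
  have hupper : ∀ x ∈ cubeC c l, x ≠ 0 →
      w x ≤ C * (R ^ (a + s) * Real.log (2 + R) ^ b) * ‖x‖ ^ (-s) := by
    intro x hx hx0
    have hxn : 0 < ‖x‖ := norm_pos_iff.2 hx0
    have hxe : 0 < euclNorm x := hxn.trans_le (norm_le_euclNorm x)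
    have hsplit : w x =
        euclNorm x ^ (a + s) * Real.log (2 + euclNorm x) ^ b * euclNorm x ^ (-s) := by
      have : euclNorm x ^ a = euclNorm x ^ (a + s) * euclNorm x ^ (-s) := by
        rw [← Real.rpow_add hxe, add_neg_cancel_right]
      simp only [hw, this]; ring
    rw [hsplit]
    exact mul_le_mul (hmono _ _ hxe hR0 (euclNorm_le_of_mem_cubeC hn hl hx))
      (Real.rpow_le_rpow_of_nonpos hxn (norm_le_euclNorm x) (by linarith))
      (by positivity) (by positivity)
  have hne : ∀ᵐ x : Fin n → ℝ, x ≠ 0 := by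
    have : Nonempty (Fin n) := ⟨⟨0, hn⟩⟩
    exact Measure.ae_ne volume 0
  have hae : ∀ᵐ x : Fin n → ℝ, x ∈ cubeC c l →
      w x ≤ C * (R ^ (a + s) * Real.log (2 + R) ^ b) * ‖x‖ ^ (-s) := by
    filter_upwards [hne] with x hx0 hx using hupper x hx hx0
  have hdom : IntegrableOn
      (fun x => C * (R ^ (a + s) * Real.log (2 + R) ^ b) * ‖x‖ ^ (-s)) (cubeC c l) :=
    (integrableOn_norm_rpow_neg_cubeC hn hsn c hl.le).const_mul _
  have hwint : IntegrableOn w (cubeC c l) := by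
    refine Integrable.mono' hdom hwmeas.aestronglyMeasurable ?_
    rw [ae_restrict_iff' (measurableSet_cubeC c hl.le)]
    filter_upwards [hae] with x hx hxc
    rw [Real.norm_of_nonneg (hw0 x)]
    exact hx hxc
  constructor
  · obtain ⟨d, hdsub, hd⟩ := exists_subcube_away_from_zero hn c hl
    have hl4 : 0 ≤ l / 4 := by positivity
    have hlower : ∀ x ∈ cubeC d (l / 4),
        (C * (4 * n) ^ s)⁻¹ * (R ^ a * Real.log (2 + R) ^ b) ≤ w x := by
      intro x hx
      have hRx := hd x hx
      have hxR := euclNorm_le_of_mem_cubeC hn hl (hdsub hx)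
      have hxe : 0 < euclNorm x := pos_of_mul_pos_right (hR0.trans_le hRx) (by positivity)
      have hLx : 0 < Real.log (2 + euclNorm x) := Real.log_pos (by linarith)
      rw [inv_mul_le_iff₀ (by positivity)]
      refine le_of_mul_le_mul_right ?_ (Real.rpow_pos_of_pos hR0 s)
      calc R ^ a * Real.log (2 + R) ^ b * R ^ s
          = R ^ (a + s) * Real.log (2 + R) ^ b := by rw [Real.rpow_add hR0]; ring
        _ ≤ C * (euclNorm x ^ (a + s) * Real.log (2 + euclNorm x) ^ b) :=
          hmono _ _ hR0 hxe hRx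
        _ = C * w x * euclNorm x ^ s := by rw [Real.rpow_add hxe]; simp only [hw]; ring
        _ ≤ C * w x * (4 * n * R) ^ s :=
          mul_le_mul_of_nonneg_left (Real.rpow_le_rpow hxe.le hxR hs0)
            (mul_nonneg hC.le (hw0 x))
        _ = C * (4 * n) ^ s * w x * R ^ s := by
          rw [Real.mul_rpow (by positivity) hR0.le]; ring
    calc (1 / 4) ^ n * (C * (4 * n) ^ s)⁻¹ * (l ^ n * (R ^ a * Real.log (2 + R) ^ b))
        = ∫ _x in cubeC d (l / 4), (C * (4 * n) ^ s)⁻¹ * (R ^ a * Real.log (2 + R) ^ b) := by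
          rw [setIntegral_const, volume_real_cubeC d hl4, smul_eq_mul, div_pow, div_pow, one_pow]
          ring
      _ ≤ ∫ x in cubeC d (l / 4), w x :=
        setIntegral_mono_on (integrableOn_const (volume_cubeC_ne_top d hl4))
          (hwint.mono_set hdsub) (measurableSet_cubeC d hl4) hlower
      _ ≤ ∫ x in cubeC c l, w x :=
        setIntegral_mono_set hwint (Filter.Eventually.of_forall hw0) hdsub.eventuallyLE
  · calc ∫ x in cubeC c l, w x
        ≤ ∫ x in cubeC c l, C * (R ^ (a + s) * Real.log (2 + R) ^ b) * ‖x‖ ^ (-s) :=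
          setIntegral_mono_on_ae hwint hdom (measurableSet_cubeC c hl.le) hae
      _ = C * (R ^ (a + s) * Real.log (2 + R) ^ b) * ∫ x in cubeC c l, ‖x‖ ^ (-s) :=
        integral_const_mul _ _
      _ ≤ C * (R ^ (a + s) * Real.log (2 + R) ^ b) * (D * (l ^ n * R ^ (-s))) :=
        mul_le_mul_of_nonneg_left (hcube c l hl) (by positivity)
      _ = C * D * (l ^ n * (R ^ (a + s) * R ^ (-s) * Real.log (2 + R) ^ b)) := by ring
      _ = C * D * (l ^ n * (R ^ a * Real.log (2 + R) ^ b)) := by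
        rw [← Real.rpow_add hR0, add_neg_cancel_right]

/-- For `a ∈ (-n,∞)`, `b ∈ ℝ` and `w(x) = |x|^a (log(2+|x|))^b`, for every `λ ≥ 1` and
every cube `Q` (center `c`, edge `l`), `w(λQ)/w(Q)` is comparable to
`λⁿ ((|c|+λl)/(|c|+l))^a (log(2+|c|+λl)/log(2+|c|+l))^b`, with constants depending
only on `n, a, b`. -/
theorem dilated_cube_mass_comparable {n : ℕ} (hn : 0 < n) (a b : ℝ) (ha : -(n : ℝ) < a) :
    ∃ c₁ c₂ : ℝ, 0 < c₁ ∧ 0 < c₂ ∧ ∀ (lam : ℝ), 1 ≤ lam →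
      ∀ (c : Fin n → ℝ) (l : ℝ), 0 < l →
      c₁ * ((lam ^ (n : ℝ) * ((euclNorm c + lam * l) / (euclNorm c + l)) ^ a *
            (Real.log (2 + euclNorm c + lam * l) / Real.log (2 + euclNorm c + l)) ^ b) *
          ∫ x in cubeC c l, euclNorm x ^ a * Real.log (2 + euclNorm x) ^ b) ≤
        (∫ x in cubeC c (lam * l), euclNorm x ^ a * Real.log (2 + euclNorm x) ^ b) ∧
      (∫ x in cubeC c (lam * l), euclNorm x ^ a * Real.log (2 + euclNorm x) ^ b) ≤
        c₂ * ((lam ^ (n : ℝ) * ((euclNorm c + lam * l) / (euclNorm c + l)) ^ a *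
            (Real.log (2 + euclNorm c + lam * l) / Real.log (2 + euclNorm c + l)) ^ b) *
          ∫ x in cubeC c l, euclNorm x ^ a * Real.log (2 + euclNorm x) ^ b) := by
  obtain ⟨A, B, hA, hB, hAB⟩ := cubeC_mass_comparable hn a b ha
  refine ⟨A / B, B / A, by positivity, by positivity, fun lam hlam c l hl => ?_⟩
  have hlam0 : 0 < lam := by linarith
  have hcE := euclNorm_nonneg c
  obtain ⟨hQlow, hQup⟩ := hAB c l hl
  obtain ⟨hlamQlow, hlamQup⟩ := hAB c (lam * l) (by positivity)
  rw [add_assoc 2 (euclNorm c) (lam * l), add_assoc 2 (euclNorm c) l]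
  have hR0 : 0 < euclNorm c + l := by positivity
  have hS0 : 0 < euclNorm c + lam * l := by positivity
  have hLR : 0 < Real.log (2 + (euclNorm c + l)) := Real.log_pos (by linarith)
  have hLS : 0 < Real.log (2 + (euclNorm c + lam * l)) := Real.log_pos (by linarith)
  rw [Real.rpow_natCast, Real.div_rpow hS0.le hR0.le, Real.div_rpow hLS.le hLR.le]
  rw [mul_pow] at hlamQlow hlamQup
  have hRa := Real.rpow_pos_of_pos hR0 a
  have hSa := Real.rpow_pos_of_pos hS0 a
  have hLRb := Real.rpow_pos_of_pos hLR b
  have hLSb := Real.rpow_pos_of_pos hLS b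
  generalize (euclNorm c + l) ^ a = Ra at *
  generalize (euclNorm c + lam * l) ^ a = Sa at *
  generalize Real.log (2 + (euclNorm c + l)) ^ b = Rb at *
  generalize Real.log (2 + (euclNorm c + lam * l)) ^ b = Sb at *
  constructor
  · refine le_trans ?_ hlamQlow
    calc _ ≤ A / B * (lam ^ n * (Sa / Ra) * (Sb / Rb) * (B * (l ^ n * (Ra * Rb)))) := by gcongr
      _ = _ := by field_simp
  · refine hlamQup.trans ?_
    calc _ = B / A * (lam ^ n * (Sa / Ra) * (Sb / Rb) * (A * (l ^ n * (Ra * Rb)))) := by field_simp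
      _ ≤ _ := by gcongr
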